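/- For every integer d ≥ 2 there is a constant C_d > 0 with the following property. Let p be prime and Γ ⊆ F_p^* a multiplicative subgroup with |Γ| < p^{1/2}, and let r_d(ξ) := #{(x₁,…,x_d) ∈ Γ^d : x₁ + ⋯ + x_d = ξ}. Then for every j ≥ 1 and every collection ξ₁, …, ξ_j of j nonzero elements of F_p lying in pairwise distinct cosets of Γ (i.e. ξ_i/ξ_{i'} ∉ Γ for i ≠ i'), one has min_{1 ≤ i ≤ j} r_d(ξ_i) ≤ C_d · |Γ|^{d − 2 + (1 + 2^{2−d})/3} · j^{−1/3}. -/

import Mathlib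

open Finset

/-- `r_d(ξ)` = the number of ordered representations of `ξ` as a sum of `d` elements of `Γ`. -/
def repCount {p : ℕ} [NeZero p] (d : ℕ) (Γ : Finset (ZMod p)) (ξ : ZMod p) : ℕ :=
  Fintype.card {x : Fin d → ZMod p // (∀ i, x i ∈ Γ) ∧ ∑ i, x i = ξ}


section Stepanov

open Polynomial

variable {F : Type*} [Field F]

/-- A nonzero polynomial of degree less than the characteristic with `s` monomials
vanishes at `1` to order less than `s`. -/
theorem Polynomial.lt_card_support_of_pow_dvd {p : ℕ} [CharP F p] (s : ℕ) :
    ∀ (f : F[X]) (k : ℕ), f.support.card = s → f ≠ 0 → f.natDegree < p →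
      (1 - X) ^ k ∣ f → k < s := by
  induction s with
  | zero =>
    intro f k hs hf
    exact absurd (by simpa using hs) hf
  | succ s ih =>
    intro f k hs hf hdeg hdvd
    rcases Nat.eq_zero_or_pos k with rfl | hk
    · omega
    obtain ⟨n, hn⟩ := Polynomial.nonempty_support_iff.mpr hf
    set g : F[X] := X * derivative f - C (n : F) * f with hg
    have hcoeff : ∀ m, g.coeff m = ((m : F) - n) * f.coeff m := by
      intro m
      rcases m with _ | m
      · simp [hg]
      · simp [hg, coeff_X_mul, coeff_derivative]
        ring
    have hsupp : g.support = f.support.erase n := by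
      ext m
      rw [mem_support_iff, hcoeff, mem_erase, mem_support_iff, mul_ne_zero_iff]
      refine and_congr_left fun hm => ?_
      have hmp : m < p := (le_natDegree_of_ne_zero hm).trans_lt hdeg
      have hnp : n < p := (le_natDegree_of_mem_supp n hn).trans_lt hdeg
      rw [sub_ne_zero, not_iff_not]
      constructor
      · intro h
        exact CharP.natCast_injOn_Iio F p hmp hnp h
      · rintro rfl
        rfl
    have hcard : g.support.card = s := by
      rw [hsupp, card_erase_of_mem hn, hs]
      rfl
    have hdvd' : (1 - X) ^ (k - 1) ∣ g := by
      obtain ⟨q, rfl⟩ := hdvd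
      obtain ⟨l, rfl⟩ : ∃ l, k = l + 1 := ⟨k - 1, by omega⟩
      refine dvd_sub (Dvd.dvd.mul_left ?_ _) (Dvd.dvd.mul_left ?_ _)
      · rw [derivative_mul, derivative_pow_succ]
        refine dvd_add ⟨C ((l : F) + 1) * derivative (1 - X) * q, ?_⟩
          (Dvd.dvd.mul_right (pow_dvd_pow _ (by omega)) _)
        simp only [Nat.add_sub_cancel]
        ring
      · exact Dvd.dvd.mul_right (pow_dvd_pow _ (by omega)) _
    by_cases hg0 : g = 0
    · exfalso
      have hs0 : s = 0 := by rw [← hcard, hg0]; simp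
      obtain ⟨m, c, hc, rfl⟩ := card_support_eq_one.mp (hs.trans (by rw [hs0]))
      have h1 : (1 - X : F[X]) ∣ C c * X ^ m := (dvd_pow_self _ (by omega)).trans hdvd
      obtain ⟨q, hq⟩ := h1
      have := congrArg (eval 1) hq
      simp at this
      exact hc this
    · have hgdeg : g.natDegree < p := by
        refine lt_of_le_of_lt ?_ hdeg
        refine natDegree_le_natDegree (Polynomial.degree_mono ?_)
        rw [hsupp]
        exact erase_subset _ _
      have := ih g (k - 1) hcard hg0 hgdeg hdvd'
      omega

/-- The derivation `X (1 - X) d/dX`. -/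
noncomputable def eulerOp (F : Type*) [Field F] : F[X] →ₗ[F] F[X] :=
  LinearMap.mulLeft F (X * (1 - X)) ∘ₗ derivative

theorem eulerOp_apply (f : F[X]) : eulerOp F f = X * (1 - X) * derivative f := rfl

theorem le_rootMultiplicity_of_eulerOp {p : ℕ} [CharP F p] {x : F} (hx0 : x ≠ 0)
    (hx1 : x ≠ 1) (D : ℕ) : ∀ f : F[X], f ≠ 0 → D ≤ p →
      (∀ k < D, ((eulerOp F ^ k) f).eval x = 0) → D ≤ f.rootMultiplicity x := by
  induction D with
  | zero => intros; exact Nat.zero_le _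
  | succ D ih =>
    intro f hf hD h
    have hroot : f.IsRoot x := by simpa using h 0 (by omega)
    by_contra! hlt
    have hpos : 0 < f.rootMultiplicity x := (rootMultiplicity_pos hf).mpr hroot
    have hn : ((f.rootMultiplicity x : ℕ) : F) ≠ 0 := by
      rw [Ne, CharP.cast_eq_zero_iff F p]
      intro hdvd
      have := Nat.le_of_dvd hpos hdvd
      omega
    have hder := derivative_rootMultiplicity_of_root_of_mem_nonZeroDivisors hroot
      (mem_nonZeroDivisors_of_ne_zero hn)
    have hderne : derivative f ≠ 0 := by
      intro h0
      obtain ⟨q, hq, hqx⟩ := exists_eq_pow_rootMultiplicity_mul_and_not_dvd f hf x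
      obtain ⟨l, hl⟩ : ∃ l, f.rootMultiplicity x = l + 1 := ⟨f.rootMultiplicity x - 1, by omega⟩
      rw [hl] at hq hn
      rw [hq, derivative_mul, derivative_X_sub_C_pow, Nat.add_sub_cancel] at h0
      have h2 : (X - C x) ^ l * (C ((l + 1 : ℕ) : F) * q + (X - C x) * derivative q) = 0 := by
        rw [← h0]; ring
      rcases mul_eq_zero.mp h2 with h3 | h3
      · exact pow_ne_zero _ (X_sub_C_ne_zero x) h3
      · apply hqx
        rw [dvd_iff_isRoot]
        have := congrArg (eval x) h3
        simp only [eval_add, eval_mul, eval_C, eval_sub, eval_X, sub_self, zero_mul, add_zero,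
          eval_zero] at this
        exact (mul_eq_zero.mp this).resolve_left hn
    have hne : eulerOp F f ≠ 0 := by
      rw [eulerOp_apply]
      refine mul_ne_zero (mul_ne_zero X_ne_zero ?_) hderne
      intro h0
      have := congrArg (eval 0) h0
      simp at this
    have hmul : (eulerOp F f).rootMultiplicity x = (derivative f).rootMultiplicity x := by
      rw [eulerOp_apply] at hne ⊢
      rw [rootMultiplicity_mul hne, rootMultiplicity_eq_zero, zero_add]
      simp only [IsRoot.def, eval_mul, eval_X, eval_sub, eval_one]
      exact mul_ne_zero hx0 (sub_ne_zero.mpr hx1.symm)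
    have := ih (eulerOp F f) hne (by omega) (fun k hk => by
      have := h (k + 1) (by omega)
      rwa [pow_succ] at this)
    omega

/-- The conjugate of `eulerOp` by multiplication by `X ^ m * (1 - X) ^ n`. -/
noncomputable def twistedEulerOp (m n : ℕ) (f : F[X]) : F[X] :=
  X * (1 - X) * derivative f + C (m : F) * (1 - X) * f - C (n : F) * X * f

theorem eulerOp_mul (m n : ℕ) (f : F[X]) :
    eulerOp F (f * (X ^ m * (1 - X) ^ n)) =
      twistedEulerOp m n f * (X ^ m * (1 - X) ^ n) := by
  rw [eulerOp_apply, twistedEulerOp, derivative_mul, derivative_mul]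
  rcases m with _ | m <;> rcases n with _ | n <;>
    simp [derivative_pow] <;> ring

theorem eulerOp_pow_mul (m n k : ℕ) (f : F[X]) :
    (eulerOp F ^ k) (f * (X ^ m * (1 - X) ^ n)) =
      (twistedEulerOp m n)^[k] f * (X ^ m * (1 - X) ^ n) := by
  induction k generalizing f with
  | zero => simp
  | succ k ih =>
    rw [pow_succ, Module.End.mul_apply, eulerOp_mul, ih, Function.iterate_succ_apply]

theorem natDegree_twistedEulerOp_le (m n : ℕ) (f : F[X]) :
    (twistedEulerOp m n f).natDegree ≤ f.natDegree + 1 := by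
  have h1 : (1 - X : F[X]).natDegree ≤ 1 := by
    rw [natDegree_sub]; simpa using natDegree_sub_le_of_le (m := 1) (n := 1)
      (natDegree_X_le (R := F)) (by simp : (1 : F[X]).natDegree ≤ 1)
  unfold twistedEulerOp
  refine natDegree_sub_le_of_le (natDegree_add_le_of_le (m := f.natDegree + 1)
    (n := f.natDegree + 1) ?_ ?_) (n := f.natDegree + 1) ?_ |>.trans (by simp)
  · rcases Nat.eq_zero_or_pos f.natDegree with h | h
    · rw [natDegree_eq_zero] at h
      obtain ⟨c, rfl⟩ := h
      simp
    · refine natDegree_mul_le_of_le (natDegree_mul_le_of_le natDegree_X_le h1)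
        (natDegree_derivative_le f) |>.trans (by omega)
  · refine natDegree_mul_le_of_le (natDegree_mul_le_of_le (natDegree_C _).le h1) le_rfl
      |>.trans (by omega)
  · refine natDegree_mul_le_of_le (natDegree_mul_le_of_le (natDegree_C _).le natDegree_X_le) le_rfl
      |>.trans (by omega)

theorem natDegree_iterate_twistedEulerOp_le (m n k : ℕ) (f : F[X]) :
    ((twistedEulerOp m n)^[k] f).natDegree ≤ f.natDegree + k := by
  induction k with
  | zero => simp
  | succ k ih =>
    rw [Function.iterate_succ_apply']
    exact (natDegree_twistedEulerOp_le _ _ _).trans (by omega)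


theorem eq_zero_of_sum_pow_mul_eq_zero {R : Type*} [CommRing R] [IsDomain R] {Y : R}
    (hY : Y ≠ 0) (B : ℕ) : ∀ g : Fin B → R, (∀ c, Y ∣ g c → g c = 0) →
      ∑ c : Fin B, Y ^ (c : ℕ) * g c = 0 → ∀ c, g c = 0 := by
  induction B with
  | zero => exact fun _ _ _ c => c.elim0
  | succ B ih =>
    intro g hg hsum
    rw [Fin.sum_univ_succ] at hsum
    have hfac : ∑ c : Fin B, Y ^ (c.succ : ℕ) * g c.succ =
        Y * ∑ c : Fin B, Y ^ (c : ℕ) * g c.succ := by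
      rw [mul_sum]
      exact sum_congr rfl fun c _ => by rw [Fin.val_succ, pow_succ]; ring
    rw [hfac, Fin.val_zero, pow_zero, one_mul] at hsum
    have h0 : g 0 = 0 := hg 0 ⟨-∑ c : Fin B, Y ^ (c : ℕ) * g c.succ, by linear_combination hsum⟩
    rw [h0, zero_add] at hsum
    exact Fin.cases h0 (ih _ (fun c => hg c.succ) ((mul_eq_zero.mp hsum).resolve_left hY))

/-- The auxiliary polynomial of Stepanov's method. -/
noncomputable def stepanovPoly (t : ℕ) {A B : ℕ} (lam : Fin A × Fin B × Fin B → F) : F[X] :=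
  ∑ i, C (lam i) * (X ^ (i.1 : ℕ) * (X ^ (t * i.2.1) * (1 - X) ^ (t * i.2.2)))

theorem natDegree_one_sub_X_pow_le (n : ℕ) : ((1 - X : F[X]) ^ n).natDegree ≤ n := by
  have h1 : (1 - X : F[X]).natDegree ≤ 1 :=
    (natDegree_sub_le_of_le (m := 1) (n := 1) (by simp) natDegree_X_le).trans (by simp)
  simpa using natDegree_pow_le_of_le n h1

theorem natDegree_stepanovPoly_le (t : ℕ) {A B : ℕ} (hA : A ≤ t)
    (lam : Fin A × Fin B × Fin B → F) : (stepanovPoly t lam).natDegree ≤ 2 * (t * B) := by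
  refine natDegree_sum_le_of_forall_le _ _ fun i _ => ?_
  have h1 := natDegree_mul_le_of_le (natDegree_C (lam i)).le
    (natDegree_mul_le_of_le (natDegree_X_pow_le (R := F) (i.1 : ℕ)) (natDegree_mul_le_of_le
      (natDegree_X_pow_le (R := F) (t * i.2.1)) (natDegree_one_sub_X_pow_le (t * i.2.2))))
  refine h1.trans ?_
  have h2 : t * ((i.2.1 : ℕ) + 1) ≤ t * B := Nat.mul_le_mul_left t i.2.1.2
  have h3 : t * ((i.2.2 : ℕ) + 1) ≤ t * B := Nat.mul_le_mul_left t i.2.2.2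
  have := i.1.2
  rw [mul_add] at h2 h3
  omega

theorem stepanovPoly_ne_zero {p : ℕ} [CharP F p] {t A B : ℕ} (hAB : A * B ≤ t)
    (hp : t * B ≤ p) (hB : 0 < B) {lam : Fin A × Fin B × Fin B → F} (hlam : lam ≠ 0) :
    stepanovPoly t lam ≠ 0 := by
  have hAt : A ≤ t := (Nat.le_mul_of_pos_right A hB).trans hAB
  intro h0
  set g : Fin B → F[X] := fun c => ∑ i : Fin A × Fin B, C (lam (i.1, i.2, c)) *
    X ^ ((i.1 : ℕ) + t * i.2) with hg
  have hinj : Function.Injective fun i : Fin A × Fin B => (i.1 : ℕ) + t * i.2 := by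
    rintro ⟨a, b⟩ ⟨a', b'⟩ h
    simp only at h
    have ha : (a : ℕ) < t := a.2.trans_le hAt
    have ha' : (a' : ℕ) < t := a'.2.trans_le hAt
    have hmod := congrArg (· % t) h
    simp only [Nat.add_mul_mod_self_left, Nat.mod_eq_of_lt ha, Nat.mod_eq_of_lt ha'] at hmod
    rw [hmod] at h
    have hb := Nat.eq_of_mul_eq_mul_left (by omega) (Nat.add_left_cancel h)
    exact Prod.ext (Fin.ext hmod) (Fin.ext hb)
  have hcoeff : ∀ c (i : Fin A × Fin B), (g c).coeff (i.1 + t * i.2) = lam (i.1, i.2, c) := by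
    intro c i
    rw [hg, finsetSum_coeff, sum_eq_single i]
    · simp
    · intro k _ hk
      rw [coeff_C_mul_X_pow, if_neg]
      exact fun h => hk (hinj h).symm
    · simp
  have hsupp : ∀ c, (g c).support ⊆
      univ.image fun i : Fin A × Fin B => (i.1 : ℕ) + t * i.2 := by
    intro c n hn
    rw [mem_support_iff, hg, finsetSum_coeff] at hn
    obtain ⟨i, -, hi⟩ := exists_ne_zero_of_sum_ne_zero hn
    rw [coeff_C_mul_X_pow] at hi
    rw [mem_image]
    refine ⟨i, mem_univ _, ?_⟩
    by_contra hne
    exact hi (if_neg (fun h => hne h.symm))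
  have hsum : ∑ c : Fin B, ((1 - X : F[X]) ^ t) ^ (c : ℕ) * g c = 0 := by
    rw [← h0, stepanovPoly, ← (Equiv.prodAssoc (Fin A) (Fin B) (Fin B)).sum_comp,
      Fintype.sum_prod_type_right]
    refine sum_congr rfl fun c _ => ?_
    rw [hg, mul_sum]
    refine sum_congr rfl fun i _ => ?_
    simp only [Equiv.prodAssoc_apply]
    rw [pow_add, ← pow_mul]
    ring
  have hY : (1 - X : F[X]) ^ t ≠ 0 := by
    refine pow_ne_zero _ fun h => ?_
    simpa using congrArg (eval 0) h
  have hall := eq_zero_of_sum_pow_mul_eq_zero hY B g (fun c hdvd => by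
    by_contra hne
    have hdeg : (g c).natDegree < p := by
      obtain ⟨i, -, hi⟩ := mem_image.mp (hsupp c (natDegree_mem_support_of_nonzero hne))
      rw [← hi]
      have h1 : t * ((i.2 : ℕ) + 1) ≤ t * B := Nat.mul_le_mul_left t i.2.2
      have h2 := i.1.2
      rw [mul_add] at h1
      omega
    have hlt := lt_card_support_of_pow_dvd _ (g c) t rfl hne hdeg hdvd
    have hle := (card_le_card (hsupp c)).trans card_image_le
    rw [card_univ, Fintype.card_prod, Fintype.card_fin, Fintype.card_fin] at hle
    omega) hsum
  apply hlam
  funext i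
  rw [← hcoeff i.2.2 (i.1, i.2.1), hall]
  simp

theorem card_mul_le_of_stepanov [DecidableEq F] {p : ℕ} [CharP F p] {t A B D : ℕ}
    (S : Finset F) (Q : Finset (F × F))
    (hS : ∀ x ∈ S, x ≠ 0 ∧ x ≠ 1 ∧ (x ^ t, (1 - x) ^ t) ∈ Q)
    (hcond : #Q * (D * (A + D)) < A * (B * B)) (hAB : A * B ≤ t) (hp : t * B ≤ p)
    (hD : D ≤ p) : #S * D ≤ 2 * (t * B) := by
  have hB : 0 < B := by
    rcases Nat.eq_zero_or_pos B with rfl | h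
    · simp at hcond
    · exact h
  have hAt : A ≤ t := (Nat.le_mul_of_pos_right A hB).trans hAB
  let P : ℕ → Fin A × Fin B × Fin B → F[X] := fun k i =>
    (twistedEulerOp (t * i.2.1) (t * i.2.2))^[k] (X ^ (i.1 : ℕ))
  let M : Matrix (Q × Fin D × Fin (A + D)) (Fin A × Fin B × Fin B) F := fun c i =>
    (c.1 : F × F).1 ^ (i.2.1 : ℕ) * (c.1 : F × F).2 ^ (i.2.2 : ℕ) * (P c.2.1 i).coeff c.2.2
  have hker : LinearMap.ker M.mulVecLin ≠ ⊥ := by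
    apply LinearMap.ker_ne_bot_of_finrank_lt
    simpa using hcond
  obtain ⟨lam, hlam, hne⟩ := (Submodule.ne_bot_iff _).mp hker
  rw [LinearMap.mem_ker, Matrix.mulVecLin_apply] at hlam
  have hpoly := stepanovPoly_ne_zero hAB hp hB hne
  have hmult : ∀ x ∈ S, D ≤ (stepanovPoly t lam).rootMultiplicity x := by
    intro x hx
    obtain ⟨hx0, hx1, hxQ⟩ := hS x hx
    refine le_rootMultiplicity_of_eulerOp hx0 hx1 D _ hpoly hD fun k hk => ?_
    have heq : ((eulerOp F ^ k) (stepanovPoly t lam)).eval x =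
        ∑ n : Fin (A + D), (M.mulVec lam) (⟨_, hxQ⟩, ⟨k, hk⟩, n) * x ^ (n : ℕ) := by
      simp only [Matrix.mulVec, dotProduct, sum_mul]
      rw [sum_comm, stepanovPoly, map_sum, eval_finsetSum]
      refine sum_congr rfl fun i _ => ?_
      rw [← smul_eq_C_mul, map_smul, eulerOp_pow_mul, eval_smul, eval_mul,
        eval_eq_sum_range' (n := A + D)]
      · rw [← Fin.sum_univ_eq_sum_range (fun n => coeff _ n * x ^ n), smul_eq_mul, sum_mul,
          mul_sum]
        refine sum_congr rfl fun n _ => ?_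
        simp only [M, P, eval_mul, eval_pow, eval_X, eval_sub, eval_one]
        rw [pow_mul, pow_mul]
        ring
      · have := natDegree_iterate_twistedEulerOp_le (t * i.2.1) (t * i.2.2) k
          (X ^ (i.1 : ℕ) : F[X])
        rw [natDegree_X_pow] at this
        have := i.1.2
        omega
    rw [heq, hlam]
    simp
  calc #S * D = ∑ _x ∈ S, D := by rw [sum_const, smul_eq_mul]
    _ ≤ ∑ x ∈ S, (stepanovPoly t lam).roots.count x :=
        sum_le_sum fun x hx => by rw [count_roots]; exact hmult x hx
    _ ≤ (stepanovPoly t lam).roots.card := by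
        rw [← Multiset.toFinset_sum_count_eq]
        refine (sum_le_sum_of_subset (subset_union_left (s₂ := (stepanovPoly t lam).roots.toFinset))).trans_eq
          (sum_subset subset_union_right fun x _ hx => ?_).symm
        rw [Multiset.mem_toFinset] at hx
        exact Multiset.count_eq_zero_of_notMem hx
    _ ≤ (stepanovPoly t lam).natDegree := card_roots' _
    _ ≤ 2 * (t * B) := natDegree_stepanovPoly_le t hAt lam

/-- If the cube of `B` exceeds `2 * #Q * t`, Stepanov's method gives a bound `4 * B ^ 2`. -/
theorem card_le_of_two_mul_lt_cube [DecidableEq F] {p : ℕ} [CharP F p] {t B : ℕ}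
    (ht : t * t < p) (S : Finset F) (Q : Finset (F × F))
    (hS : ∀ x ∈ S, x ≠ 0 ∧ x ≠ 1 ∧ (x ^ t, (1 - x) ^ t) ∈ Q)
    (hQ : 2 * #Q * t < B ^ 3) (hB : B ≤ t) : #S ≤ 4 * B ^ 2 := by
  have hB0 : 0 < B := by
    rcases Nat.eq_zero_or_pos B with rfl | h
    · simp at hQ
    · exact h
  have hA0 : 0 < t / B := Nat.div_pos hB hB0
  have hAB : t / B * B ≤ t := Nat.div_mul_le_self t B
  have hlt : t < 2 * (t / B * B) := by
    have h1 := Nat.lt_div_mul_add (a := t) hB0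
    have h2 : 1 * B ≤ t / B * B := Nat.mul_le_mul_right B hA0
    omega
  have hcond : #Q * (t / B * (t / B + t / B)) < t / B * (B * B) := by
    have h1 : B * (2 * #Q * (t / B)) < B * (B * B) := by
      calc B * (2 * #Q * (t / B)) = 2 * #Q * (t / B * B) := by ring
        _ ≤ 2 * #Q * t := Nat.mul_le_mul_left _ hAB
        _ < B ^ 3 := hQ
        _ = B * (B * B) := by ring
    calc #Q * (t / B * (t / B + t / B)) = t / B * (2 * #Q * (t / B)) := by ring
      _ < t / B * (B * B) := Nat.mul_lt_mul_of_pos_left (Nat.lt_of_mul_lt_mul_left h1) hA0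
  have htt : t ≤ t * t := Nat.le_mul_self t
  have hmain := card_mul_le_of_stepanov S Q hS hcond hAB
    ((Nat.mul_le_mul_left t hB).trans ht.le) ((Nat.div_le_self t B).trans (htt.trans ht.le))
  have hBA : 0 < t / B := hA0
  refine Nat.le_of_mul_le_mul_right (hmain.trans ?_) hA0
  calc 2 * (t * B) ≤ 2 * (2 * (t / B * B) * B) :=
        Nat.mul_le_mul_left _ (Nat.mul_le_mul_right _ hlt.le)
    _ = 4 * B ^ 2 * (t / B) := by ring

end Stepanov

section Subgroup

variable {p : ℕ} [Fact p.Prime]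

/-- Combining Stepanov's bound over blocks of pairs. -/
theorem card_le_of_pow_mem_aux {t : ℕ} (ht : t * t < p) (S : Finset (ZMod p))
    (Q : Finset (ZMod p × ZMod p)) (hS : ∀ x ∈ S, x ≠ 0 ∧ x ≠ 1 ∧ (x ^ t, (1 - x) ^ t) ∈ Q)
    (hQ : 2 * #Q < t * t) : #S ^ 3 ≤ 2 ^ 14 * (#Q * t) ^ 2 := by
  have ht0 : 0 < t := by
    rcases Nat.eq_zero_or_pos t with rfl | h
    · simp at hQ
    · exact h
  rcases Q.eq_empty_or_nonempty with rfl | hQne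
  · have : S = ∅ := eq_empty_of_forall_notMem fun x hx => by simpa using (hS x hx).2.2
    simp [this]
  have hex : ∃ B, 2 * #Q * t < B ^ 3 := ⟨t, by nlinarith⟩
  have hB : 2 * #Q * t < Nat.find hex ^ 3 := Nat.find_spec hex
  have hBt : Nat.find hex ≤ t := Nat.find_min' hex (by nlinarith)
  have hcard := card_le_of_two_mul_lt_cube ht S Q hS hB hBt
  have hmin := fun m (hm : m < Nat.find hex) => not_lt.mp (Nat.find_min hex hm)
  generalize Nat.find hex = B at *
  have hpos : 1 ≤ #Q * t := Nat.mul_pos hQne.card_pos ht0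
  obtain ⟨b, rfl⟩ : ∃ b, B = b + 2 := by
    refine ⟨B - 2, ?_⟩
    have : 2 ≤ B := by
      by_contra! h
      interval_cases B <;> nlinarith
    omega
  have hb := hmin (b + 1) (by omega)
  calc #S ^ 3 ≤ (4 * (b + 2) ^ 2) ^ 3 := Nat.pow_le_pow_left hcard 3
    _ ≤ (4 * (2 * (b + 1)) ^ 2) ^ 3 := by gcongr; omega
    _ = 2 ^ 12 * ((b + 1) ^ 3) ^ 2 := by ring
    _ ≤ 2 ^ 12 * (2 * #Q * t) ^ 2 := by gcongr
    _ = 2 ^ 14 * (#Q * t) ^ 2 := by ring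

theorem card_le_of_pow_mem {t : ℕ} (ht0 : 0 < t) (ht : t * t < p) (S : Finset (ZMod p))
    (Q : Finset (ZMod p × ZMod p)) (hS : ∀ x ∈ S, x ≠ 0 ∧ x ≠ 1 ∧ (x ^ t, (1 - x) ^ t) ∈ Q) :
    #S ^ 3 ≤ 2 ^ 14 * (#Q * t) ^ 2 ∨ #S ≤ 82 * #Q := by
  by_cases hQ : 2 * #Q < t * t
  · exact Or.inl (card_le_of_pow_mem_aux ht S Q hS hQ)
  refine Or.inr ?_
  obtain rfl | ht2 : t = 1 ∨ 2 ≤ t := by omega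
  · have : #S ≤ #Q := card_le_card_of_injOn (fun x => (x, 1 - x))
      (fun x hx => by simpa using (hS x hx).2.2) fun x _ y _ h => (Prod.ext_iff.mp h).1
    omega
  set m := (t * t - 1) / 2 with hm
  have htt : 4 ≤ t * t := Nat.mul_le_mul ht2 ht2
  have hm1 : 2 * m < t * t := by omega
  have hm2 : t * t ≤ 4 * m := by omega
  have hmQ : m ≤ #Q := by omega
  suffices H : ∀ n, ∀ (S : Finset (ZMod p)) (Q : Finset (ZMod p × ZMod p)), #Q = n →
      (∀ x ∈ S, x ≠ 0 ∧ x ≠ 1 ∧ (x ^ t, (1 - x) ^ t) ∈ Q) → #S ≤ 41 * (n + m) by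
    have := H _ S Q rfl hS
    omega
  have small : ∀ (S : Finset (ZMod p)) (Q : Finset (ZMod p × ZMod p)), #Q ≤ m →
      (∀ x ∈ S, x ≠ 0 ∧ x ≠ 1 ∧ (x ^ t, (1 - x) ^ t) ∈ Q) → #S ≤ 41 * m := by
    intro S Q hQm hS
    refine le_of_pow_le_pow_left₀ (n := 3) (by norm_num) (Nat.zero_le _) ?_
    calc #S ^ 3 ≤ 2 ^ 14 * (#Q * t) ^ 2 := card_le_of_pow_mem_aux ht S Q hS (by omega)
      _ = 2 ^ 14 * (#Q ^ 2 * (t * t)) := by ring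
      _ ≤ 2 ^ 14 * (m ^ 2 * (4 * m)) := by gcongr
      _ = 65536 * m ^ 3 := by ring
      _ ≤ (41 * m) ^ 3 := by rw [mul_pow]; gcongr; norm_num
  intro n
  induction n using Nat.strong_induction_on with
  | _ n ih =>
    intro S Q hn hS
    by_cases hnm : n ≤ m
    · exact (small S Q (hn.le.trans hnm) hS).trans (by omega)
    obtain ⟨Q₀, hQ₀, hcard⟩ := exists_subset_card_eq (show m ≤ #Q by omega)
    rw [← card_filter_add_card_filter_not (s := S) (fun x => (x ^ t, (1 - x) ^ t) ∈ Q₀)]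
    have h1 := small (S.filter fun x => (x ^ t, (1 - x) ^ t) ∈ Q₀) Q₀ hcard.le fun x hx => by
      rw [mem_filter] at hx
      exact ⟨(hS x hx.1).1, (hS x hx.1).2.1, hx.2⟩
    have h2 := ih (n - m) (by omega) (S.filter fun x => (x ^ t, (1 - x) ^ t) ∉ Q₀) (Q \ Q₀)
      (by rw [card_sdiff_of_subset hQ₀]; omega) fun x hx => by
        rw [mem_filter] at hx
        exact ⟨(hS x hx.1).1, (hS x hx.1).2.1, mem_sdiff.mpr ⟨(hS x hx.1).2.2, hx.2⟩⟩
    omega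

theorem repCount_zero (Γ : Finset (ZMod p)) (ξ : ZMod p) :
    repCount 0 Γ ξ = if 0 = ξ then 1 else 0 := by
  simp only [repCount, Fintype.card_subtype]
  split_ifs with h <;> simp [h]

theorem repCount_succ (d : ℕ) (Γ : Finset (ZMod p)) (ξ : ZMod p) :
    repCount (d + 1) Γ ξ = ∑ y ∈ Γ, repCount d Γ (ξ - y) := by
  have h : ∀ n η, repCount n Γ η =
      ∑ x : Fin n → ZMod p, if (∀ i, x i ∈ Γ) ∧ ∑ i, x i = η then 1 else 0 := by
    intro n η
    rw [repCount, Fintype.card_subtype, card_filter]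
  rw [h, ← (Fin.consEquiv fun _ => ZMod p).sum_comp, Fintype.sum_prod_type,
    ← sum_filter_add_sum_filter_not univ (· ∈ Γ), filter_mem_eq_inter, univ_inter]
  rw [sum_eq_zero (s := univ.filter (· ∉ Γ)), add_zero]
  · refine sum_congr rfl fun y hy => ?_
    rw [h]
    refine sum_congr rfl fun x _ => ?_
    congr 1
    simp [Fin.consEquiv, Fin.forall_fin_succ, Fin.sum_univ_succ, hy, eq_sub_iff_add_eq']
  · intro y hy
    refine sum_eq_zero fun x _ => if_neg ?_
    rw [mem_filter] at hy
    simp [Fin.consEquiv, Fin.forall_fin_succ, hy.2]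

theorem sum_repCount (d : ℕ) (Γ : Finset (ZMod p)) : ∑ ξ, repCount d Γ ξ = #Γ ^ d := by
  induction d with
  | zero =>
    simp [repCount_zero]
  | succ d ih =>
    simp_rw [repCount_succ]
    rw [sum_comm]
    have h : ∀ y, ∑ ξ, repCount d Γ (ξ - y) = #Γ ^ d := fun y => by
      rw [← ih]
      exact (Equiv.subRight y).sum_comp (repCount d Γ)
    simp [h, pow_succ, mul_comm]

theorem repCount_succ_le (d : ℕ) (Γ : Finset (ZMod p)) (ξ : ZMod p) :
    repCount (d + 1) Γ ξ ≤ #Γ ^ d := by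
  rw [repCount_succ, ← sum_repCount]
  exact (sum_le_univ_sum_of_nonneg (fun _ => Nat.zero_le _)).trans_eq
    ((Equiv.subLeft ξ).sum_comp (repCount d Γ))

theorem mem_iff_pow_card_eq_one {Γ : Finset (ZMod p)} (h0 : (0 : ZMod p) ∉ Γ)
    (h1 : (1 : ZMod p) ∈ Γ) (hmul : ∀ x ∈ Γ, ∀ y ∈ Γ, x * y ∈ Γ) (x : ZMod p) :
    x ∈ Γ ↔ x ^ #Γ = 1 := by
  have hpos : 0 < #Γ := card_pos.mpr ⟨1, h1⟩
  have hpow : ∀ x ∈ Γ, x ^ #Γ = 1 := by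
    intro x hx
    have hx0 : x ≠ 0 := fun h => h0 (h ▸ hx)
    have himg : Γ.image (x * ·) = Γ := by
      refine eq_of_subset_of_card_le (image_subset_iff.mpr (hmul x hx)) ?_
      rw [card_image_of_injective _ (mul_right_injective₀ hx0)]
    have hprod : ∏ y ∈ Γ, x * y = ∏ y ∈ Γ, y := by
      conv_rhs => rw [← himg]
      rw [prod_image fun _ _ _ _ h => mul_right_injective₀ hx0 h]
    rw [prod_mul_distrib, prod_const] at hprod
    exact (mul_eq_right₀ (prod_ne_zero_iff.mpr fun y hy h => h0 (h ▸ hy))).mp hprod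
  refine ⟨hpow x, fun hx => ?_⟩
  have hsub : Γ ⊆ Polynomial.nthRootsFinset #Γ (1 : ZMod p) := fun y hy =>
    (Polynomial.mem_nthRootsFinset hpos (1 : ZMod p)).mpr (hpow y hy)
  have hcard : #(Polynomial.nthRootsFinset #Γ (1 : ZMod p)) ≤ #Γ := by
    classical
    rw [Polynomial.nthRootsFinset_def]
    exact (Multiset.toFinset_card_le _).trans (Polynomial.card_nthRoots _ _)
  rw [eq_of_subset_of_card_le hsub hcard]
  exact (Polynomial.mem_nthRootsFinset hpos (1 : ZMod p)).mpr hx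

theorem repCount_mul (d : ℕ) {Γ : Finset (ZMod p)} (hΓ : ∀ x, x ∈ Γ ↔ x ^ #Γ = 1) {g : ZMod p}
    (hg0 : g ≠ 0) (hg : g ∈ Γ) (ξ : ZMod p) : repCount d Γ (g * ξ) = repCount d Γ ξ := by
  induction d generalizing ξ with
  | zero =>
    simp [repCount_zero, hg0, eq_comm]
  | succ d ih =>
    have hmul : ∀ y, g * y ∈ Γ ↔ y ∈ Γ := fun y => by
      rw [hΓ, mul_pow, (hΓ g).mp hg, one_mul, hΓ]
    rw [repCount_succ, repCount_succ]
    symm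
    refine sum_bij (fun y _ => g * y) (fun y hy => (hmul y).mpr hy)
      (fun _ _ _ _ h => mul_left_cancel₀ hg0 h) (fun y hy => ⟨g⁻¹ * y, ?_, ?_⟩) fun y _ => ?_
    · rw [← hmul, mul_inv_cancel_left₀ hg0]
      exact hy
    · exact mul_inv_cancel_left₀ hg0 y
    · rw [← mul_sub, ih]

/-- The nonzero elements having at least `v` representations. -/
def repLevel (d : ℕ) (Γ : Finset (ZMod p)) (v : ℕ) : Finset (ZMod p) :=
  univ.filter fun η => η ≠ 0 ∧ v ≤ repCount d Γ η

/-- The number of cosets of `Γ` making up `repLevel d Γ v`. -/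
def repLevelCosets (d : ℕ) (Γ : Finset (ZMod p)) (v : ℕ) : ℕ :=
  #((repLevel d Γ v).image (· ^ #Γ))

theorem card_mul_repLevelCosets_le (d : ℕ) {Γ : Finset (ZMod p)}
    (hΓ : ∀ x, x ∈ Γ ↔ x ^ #Γ = 1) (hpos : 0 < #Γ) (v : ℕ) :
    #Γ * repLevelCosets d Γ v ≤ #(repLevel d Γ v) := by
  rw [card_eq_sum_card_image (· ^ #Γ) (repLevel d Γ v), repLevelCosets, mul_comm, ← smul_eq_mul]
  refine card_nsmul_le_sum _ _ _ fun b hb => ?_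
  obtain ⟨η, hη, rfl⟩ := mem_image.mp hb
  obtain ⟨hη0, hηv⟩ := (mem_filter.mp hη).2
  refine card_le_card_of_injOn (fun g => g * η) (fun g hg => ?_)
    fun _ _ _ _ h => mul_right_cancel₀ hη0 h
  have hg0 : g ≠ 0 := by
    rintro rfl
    have := (hΓ 0).mp hg
    rw [zero_pow hpos.ne'] at this
    exact zero_ne_one this
  simp only [coe_filter, Set.mem_ofPred_eq, repLevel, mem_filter, mem_univ, true_and]
  refine ⟨⟨mul_ne_zero hg0 hη0, ?_⟩, ?_⟩
  · rwa [repCount_mul d hΓ hg0 hg]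
  · rw [mul_pow, (hΓ g).mp hg, one_mul]

theorem sum_repLevelCosets_le (a : ℕ) {Γ : Finset (ZMod p)}
    (hΓ : ∀ x, x ∈ Γ ↔ x ^ #Γ = 1) (hpos : 0 < #Γ) (n : ℕ) :
    ∑ v ∈ Icc 1 n, repLevelCosets (a + 1) Γ v ≤ #Γ ^ a := by
  refine Nat.le_of_mul_le_mul_left ?_ hpos
  rw [mul_sum, ← pow_succ', ← sum_repCount]
  refine (sum_le_sum fun v _ => card_mul_repLevelCosets_le (a + 1) hΓ hpos v).trans ?_
  simp only [repLevel, card_filter]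
  rw [sum_comm]
  refine sum_le_sum fun η _ => ?_
  rw [← card_filter]
  refine (card_le_card (t := Icc 1 (repCount (a + 1) Γ η)) fun v hv => ?_).trans_eq (by simp)
  simp only [mem_filter, mem_Icc] at hv ⊢
  exact ⟨hv.1.1, hv.2.2⟩

theorem mul_card_mul_card_le (d : ℕ) {Γ : Finset (ZMod p)}
    (hΓ : ∀ x, x ∈ Γ ↔ x ^ #Γ = 1) (hpos : 0 < #Γ) {E : Finset (ZMod p)}
    (hE0 : (0 : ZMod p) ∉ E) (hE : Set.InjOn (· ^ #Γ) (E : Set (ZMod p))) {R : ℕ}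
    (hR : ∀ ξ ∈ E, R ≤ repCount d Γ ξ) : R * (#Γ * #E) ≤ #Γ ^ d := by
  have hsub : E ⊆ repLevel d Γ R := fun ξ hξ =>
    mem_filter.mpr ⟨mem_univ _, fun h => hE0 (h ▸ hξ), hR ξ hξ⟩
  have hle : #E ≤ repLevelCosets d Γ R := by
    rw [← card_image_of_injOn hE]
    exact card_le_card (image_subset_image hsub)
  calc R * (#Γ * #E) ≤ R * #(repLevel d Γ R) := Nat.mul_le_mul_left _
        ((Nat.mul_le_mul_left _ hle).trans (card_mul_repLevelCosets_le d hΓ hpos R))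
    _ = ∑ _η ∈ repLevel d Γ R, R := by rw [sum_const, smul_eq_mul, mul_comm]
    _ ≤ ∑ η ∈ repLevel d Γ R, repCount d Γ η := sum_le_sum fun η hη => (mem_filter.mp hη).2.2
    _ ≤ ∑ η, repCount d Γ η := sum_le_univ_sum_of_nonneg fun _ => Nat.zero_le _
    _ = #Γ ^ d := sum_repCount d Γ


/-- Stepanov's bound for the number of `(ξ, y)` in `E × Γ` with `ξ - y` in a level set. -/
theorem sum_card_sub_mem_repLevel_le (d : ℕ) {Γ : Finset (ZMod p)}
    (hΓ : ∀ x, x ∈ Γ ↔ x ^ #Γ = 1) (hpos : 0 < #Γ) (hp : #Γ * #Γ < p) {E : Finset (ZMod p)}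
    (hE0 : (0 : ZMod p) ∉ E) (hE : Set.InjOn (· ^ #Γ) (E : Set (ZMod p))) (v : ℕ) :
    (∑ ξ ∈ E, #(Γ.filter fun y => ξ - y ∈ repLevel d Γ v)) ^ 3 ≤
        2 ^ 14 * (#E * repLevelCosets d Γ v * #Γ) ^ 2 ∨
      ∑ ξ ∈ E, #(Γ.filter fun y => ξ - y ∈ repLevel d Γ v) ≤
        82 * (#E * repLevelCosets d Γ v) := by
  set P := E.sigma fun ξ => Γ.filter fun y => ξ - y ∈ repLevel d Γ v with hP
  have hEne : ∀ ξ ∈ E, ξ ≠ 0 := fun ξ hξ h => hE0 (h ▸ hξ)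
  have hΓne : ∀ y ∈ Γ, y ≠ 0 := by
    rintro y hy rfl
    have := (hΓ 0).mp hy
    rw [zero_pow hpos.ne'] at this
    exact zero_ne_one this
  have hmem : ∀ z ∈ P, z.1 ∈ E ∧ z.2 ∈ Γ ∧ z.1 - z.2 ∈ repLevel d Γ v := by
    intro z hz
    simpa [hP] using hz
  have hone : ∀ z ∈ P, 1 - (z.1 - z.2) / z.1 = z.2 / z.1 := by
    intro z hz
    have := hEne _ (hmem z hz).1
    field_simp
    ring
  have hpow : ∀ z ∈ P, (z.2 / z.1) ^ #Γ = (z.1 ^ #Γ)⁻¹ := by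
    intro z hz
    rw [div_pow, (hΓ _).mp (hmem z hz).2.1, one_div]
  set S := P.image fun z => (z.1 - z.2) / z.1 with hS
  set Q := (E ×ˢ (repLevel d Γ v).image (· ^ #Γ)).image
    fun w => (w.2 / w.1 ^ #Γ, (w.1 ^ #Γ)⁻¹) with hQ
  have hcardS : #S = ∑ ξ ∈ E, #(Γ.filter fun y => ξ - y ∈ repLevel d Γ v) := by
    rw [hS, card_image_of_injOn, hP, card_sigma]
    rintro ⟨ξ, y⟩ hz ⟨ξ', y'⟩ hz' h
    simp only at h
    have h1 : y / ξ = y' / ξ' := by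
      rw [← hone _ hz, ← hone _ hz']
      simp only [h]
    have h2 : (ξ ^ #Γ)⁻¹ = (ξ' ^ #Γ)⁻¹ := by
      rw [← hpow _ hz, ← hpow _ hz']
      simp only [h1]
    obtain rfl : ξ = ξ' := hE (hmem _ hz).1 (hmem _ hz').1 (inv_injective h2)
    obtain rfl : y = y' := (div_left_inj' (hEne _ (hmem _ hz).1)).mp h1
    rfl
  have hcardQ : #Q ≤ #E * repLevelCosets d Γ v := by
    rw [repLevelCosets, ← card_product]
    exact card_image_le
  have hSQ : ∀ x ∈ S, x ≠ 0 ∧ x ≠ 1 ∧ (x ^ #Γ, (1 - x) ^ #Γ) ∈ Q := by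
    intro x hx
    obtain ⟨z, hz, rfl⟩ := mem_image.mp hx
    obtain ⟨hzE, hzΓ, hzL⟩ := hmem z hz
    refine ⟨div_ne_zero (mem_filter.mp hzL).2.1 (hEne _ hzE), fun h => ?_, ?_⟩
    · have := hone z hz
      rw [h, sub_self] at this
      exact div_ne_zero (hΓne _ hzΓ) (hEne _ hzE) this.symm
    · refine mem_image.mpr ⟨(z.1, (z.1 - z.2) ^ #Γ),
        mem_product.mpr ⟨hzE, mem_image_of_mem _ hzL⟩, ?_⟩
      rw [hone z hz, hpow z hz, div_pow]
  rw [← hcardS]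
  refine (card_le_of_pow_mem hpos hp S Q hSQ).imp (fun h => h.trans ?_) (fun h => h.trans ?_)
  · gcongr
  · gcongr

/-- Layer-cake decomposition of the representation counts of `a + 2` summands. -/
theorem sum_repCount_succ_le (a : ℕ) {Γ : Finset (ZMod p)}
    (hΓ : ∀ x, x ∈ Γ ↔ x ^ #Γ = 1) {E : Finset (ZMod p)}
    (hE : Set.InjOn (· ^ #Γ) (E : Set (ZMod p))) :
    ∑ ξ ∈ E, repCount (a + 2) Γ ξ ≤ #Γ ^ a + ∑ v ∈ Icc 1 (#Γ ^ a),
      ∑ ξ ∈ E, #(Γ.filter fun y => ξ - y ∈ repLevel (a + 1) Γ v) := by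
  have hpt : ∀ ξ ∈ E, repCount (a + 2) Γ ξ ≤ (if ξ ∈ Γ then #Γ ^ a else 0) +
      ∑ v ∈ Icc 1 (#Γ ^ a), #(Γ.filter fun y => ξ - y ∈ repLevel (a + 1) Γ v) := by
    intro ξ _
    rw [repCount_succ, ← sum_ite_eq Γ ξ fun _ => #Γ ^ a]
    simp only [card_filter]
    rw [sum_comm, ← sum_add_distrib]
    refine sum_le_sum fun y _ => ?_
    by_cases h : ξ = y
    · rw [if_pos h]
      exact (repCount_succ_le a Γ _).trans (Nat.le_add_right _ _)
    · rw [if_neg h, zero_add, ← card_filter]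
      refine le_of_eq_of_le (by simp : _ = #(Icc 1 (repCount (a + 1) Γ (ξ - y))))
        (card_le_card fun v hv => ?_)
      rw [mem_Icc] at hv
      simp only [mem_filter, mem_Icc, repLevel, mem_univ, true_and]
      exact ⟨⟨hv.1, hv.2.trans (repCount_succ_le a Γ _)⟩, sub_ne_zero.mpr h, hv.2⟩
  refine (sum_le_sum hpt).trans ?_
  rw [sum_add_distrib, sum_comm (s := E)]
  refine Nat.add_le_add_right ?_ _
  rw [← sum_filter, sum_const, smul_eq_mul]
  refine (Nat.mul_le_mul_right _ (card_le_one.mpr fun x hx y hy => ?_)).trans_eq (one_mul _)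
  rw [mem_filter] at hx hy
  exact hE hx.1 hy.1 (((hΓ x).mp hx.2).trans ((hΓ y).mp hy.2).symm)

end Subgroup

theorem exists_cube_root {x : ℝ} (hx : 0 ≤ x) : ∃ y : ℝ, 0 ≤ y ∧ y ^ 3 = x :=
  ⟨x ^ ((3 : ℕ) : ℝ)⁻¹, Real.rpow_nonneg hx _, Real.rpow_inv_natCast_pow hx (by norm_num)⟩

theorem sq_le_of_weak_bound {φ μ c u v : ℝ} (hφ : 0 ≤ φ) (hμ : 0 < μ) (hc : 1 ≤ c) (hu : 1 ≤ u)
    (hv : 1 ≤ v) (h : v ^ 3 * φ ^ 3 ≤ c ^ 3 * μ ^ 3 * u ^ 3) :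
    φ ^ 2 ≤ φ ^ 3 / μ + μ ^ 2 * (4 * c ^ 2 * u ^ 2 * ((u + v - 1)⁻¹ - (u + v)⁻¹)) := by
  have hd : (u + v - 1)⁻¹ - (u + v)⁻¹ = 1 / ((u + v - 1) * (u + v)) := by
    have h1 : u + v - 1 ≠ 0 := by linarith
    have h2 : u + v ≠ 0 := by linarith
    field_simp
    ring
  have hd2 : 1 / (u + v) ^ 2 ≤ (u + v - 1)⁻¹ - (u + v)⁻¹ := by
    rw [hd]
    apply one_div_le_one_div_of_le
    · apply mul_pos <;> linarith
    · nlinarith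
  have hdpos : 0 ≤ (u + v - 1)⁻¹ - (u + v)⁻¹ := le_trans (by positivity) hd2
  rcases le_total μ φ with hle | hle
  · have : φ ^ 2 ≤ φ ^ 3 / μ := by
      rw [le_div_iff₀ hμ]
      nlinarith [sq_nonneg φ]
    have : 0 ≤ μ ^ 2 * (4 * c ^ 2 * u ^ 2 * ((u + v - 1)⁻¹ - (u + v)⁻¹)) := by positivity
    linarith
  · have hvφ : v * φ ≤ c * μ * u := by
      refine le_of_pow_le_pow_left₀ (n := 3) (by norm_num) (by positivity) ?_
      rw [mul_pow, mul_pow, mul_pow]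
      exact h
    have hsum : (u + v) * φ ≤ 2 * c * μ * u := by
      have h1 : u * φ ≤ u * (c * μ) := by
        apply mul_le_mul_of_nonneg_left _ (by linarith)
        nlinarith
      linarith
    have hsq : φ ^ 2 ≤ μ ^ 2 * (4 * c ^ 2 * u ^ 2 * (1 / (u + v) ^ 2)) := by
      have h2 : ((u + v) * φ) ^ 2 ≤ (2 * c * μ * u) ^ 2 := by
        apply pow_le_pow_left₀ _ hsum
        positivity
      have h3 : μ ^ 2 * (4 * c ^ 2 * u ^ 2 * (1 / (u + v) ^ 2)) =
          (2 * c * μ * u) ^ 2 / (u + v) ^ 2 := by ring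
      rw [h3, le_div_iff₀ (by positivity)]
      linarith
    have h4 : μ ^ 2 * (4 * c ^ 2 * u ^ 2 * (1 / (u + v) ^ 2)) ≤
        μ ^ 2 * (4 * c ^ 2 * u ^ 2 * ((u + v - 1)⁻¹ - (u + v)⁻¹)) := by gcongr
    have : 0 ≤ φ ^ 3 / μ := by positivity
    linarith

/-- A sequence bounded in `ℓ¹` with a weak-type tail bound, summed after taking `2/3` powers. -/
theorem sum_sq_le_of_weak_bound {φ : ℕ → ℝ} {n : ℕ} {τ ω c : ℝ} (hφ : ∀ v, 0 ≤ φ v)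
    (hτ : 0 < τ) (hω : 1 ≤ ω) (hc : 1 ≤ c) (hsum : ∑ v ∈ Icc 1 n, φ v ^ 3 ≤ τ ^ 3)
    (hweak : ∀ v : ℕ, 1 ≤ v → (v : ℝ) ^ 3 * φ v ^ 3 ≤ c ^ 3 * τ ^ 3 * ω ^ 6) :
    ∑ v ∈ Icc 1 n, φ v ^ 2 ≤ (1 + 4 * c ^ 2) * τ ^ 2 * ω := by
  have hω0 : 0 < ω := by linarith
  have hu : 1 ≤ ω ^ 3 := one_le_pow₀ hω
  have htele : ∑ v ∈ Icc 1 n, ((ω ^ 3 + (v : ℝ) - 1)⁻¹ - (ω ^ 3 + (v : ℝ))⁻¹) ≤ (ω ^ 3)⁻¹ := by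
    have h : ∑ v ∈ Icc 1 n, ((ω ^ 3 + (v : ℝ) - 1)⁻¹ - (ω ^ 3 + (v : ℝ))⁻¹) =
        (ω ^ 3)⁻¹ - (ω ^ 3 + (n : ℝ))⁻¹ := by
      induction n with
      | zero => simp
      | succ n ih =>
        rw [sum_Icc_succ_top (by omega), ih]
        · push_cast
          rw [← add_assoc, add_sub_cancel_right]
          ring
        · exact (sum_le_sum_of_subset_of_nonneg (Icc_subset_Icc_right (Nat.le_succ n))
            fun v _ _ => pow_nonneg (hφ v) 3).trans hsum
    rw [h]
    have : 0 ≤ (ω ^ 3 + (n : ℝ))⁻¹ := by positivity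
    linarith
  calc ∑ v ∈ Icc 1 n, φ v ^ 2
      ≤ ∑ v ∈ Icc 1 n, (φ v ^ 3 / (τ / ω) + (τ / ω) ^ 2 * (4 * c ^ 2 * (ω ^ 3) ^ 2 *
          ((ω ^ 3 + (v : ℝ) - 1)⁻¹ - (ω ^ 3 + (v : ℝ))⁻¹))) := by
        refine sum_le_sum fun v hv => ?_
        have hv1 := (mem_Icc.mp hv).1
        refine sq_le_of_weak_bound (hφ v) (by positivity) hc hu (by exact_mod_cast hv1) ?_
        refine (hweak v hv1).trans_eq ?_
        field_simp
    _ = (∑ v ∈ Icc 1 n, φ v ^ 3) / (τ / ω) + (τ / ω) ^ 2 * (4 * c ^ 2 * (ω ^ 3) ^ 2 *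
          ∑ v ∈ Icc 1 n, ((ω ^ 3 + (v : ℝ) - 1)⁻¹ - (ω ^ 3 + (v : ℝ))⁻¹)) := by
        rw [sum_add_distrib, sum_div, ← mul_sum, ← mul_sum]
    _ ≤ τ ^ 3 / (τ / ω) + (τ / ω) ^ 2 * (4 * c ^ 2 * (ω ^ 3) ^ 2 * (ω ^ 3)⁻¹) := by gcongr
    _ = (1 + 4 * c ^ 2) * τ ^ 2 * ω := by
        field_simp

/-- A weak `ℓ³` bound with constant `c` for the representation counts of `a + 1` summands. -/
def WeakRepBound (a : ℕ) (c : ℝ) : Prop :=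
  ∀ (p : ℕ) [Fact p.Prime] (Γ : Finset (ZMod p)), (∀ x, x ∈ Γ ↔ x ^ #Γ = 1) → 0 < #Γ →
    #Γ * #Γ < p → ∀ E : Finset (ZMod p), (0 : ZMod p) ∉ E →
      Set.InjOn (· ^ #Γ) (E : Set (ZMod p)) → ∀ R : ℕ, (∀ ξ ∈ E, R ≤ repCount (a + 1) Γ ξ) →
        (R : ℝ) ^ 3 * #E * (#Γ : ℝ) ^ 2 ≤
          c ^ 3 * (#Γ : ℝ) ^ (3 * a) * ((#Γ : ℝ) ^ ((1 / 2 : ℝ) ^ a)) ^ 2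

theorem weakRepBound_zero : WeakRepBound 0 1 := by
  intro p _ Γ hΓ hpos _ E hE0 hE R hR
  have h := mul_card_mul_card_le 1 hΓ hpos hE0 hE hR
  have h1 : R * #E ≤ 1 := by
    refine Nat.le_of_mul_le_mul_left (Eq.trans_le ?_ (h.trans_eq (pow_one _ |>.trans
      (mul_one _).symm))) hpos
    ring
  have h2 : R ^ 3 * #E ≤ 1 := by
    rcases Nat.eq_zero_or_pos #E with h0 | h0
    · simp [h0]
    · have : R ≤ 1 := (Nat.le_mul_of_pos_right R h0).trans h1
      interval_cases R <;> simp_all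
  have h3 : (R : ℝ) ^ 3 * #E ≤ 1 := by exact_mod_cast h2
  simp only [mul_zero, pow_zero, Real.rpow_one, one_pow, one_mul]
  exact mul_le_of_le_one_left (by positivity) h3

theorem WeakRepBound.repLevelCosets_le {a : ℕ} {c : ℝ} (h : WeakRepBound a c) {p : ℕ}
    [Fact p.Prime] {Γ : Finset (ZMod p)} (hΓ : ∀ x, x ∈ Γ ↔ x ^ #Γ = 1) (hpos : 0 < #Γ)
    (hp : #Γ * #Γ < p) (v : ℕ) :
    (v : ℝ) ^ 3 * repLevelCosets (a + 1) Γ v * (#Γ : ℝ) ^ 2 ≤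
      c ^ 3 * (#Γ : ℝ) ^ (3 * a) * ((#Γ : ℝ) ^ ((1 / 2 : ℝ) ^ a)) ^ 2 := by
  obtain ⟨E, hEL, hE, himg⟩ := exists_subset_injOn_image_eq_of_surjOn
    (repLevel (a + 1) Γ v : Set (ZMod p)) ((repLevel (a + 1) Γ v).image (· ^ #Γ))
    (f := (· ^ #Γ)) (by rw [coe_image]; exact Set.surjOn_image _ _)
  have hmem : ∀ ξ ∈ E, ξ ≠ 0 ∧ v ≤ repCount (a + 1) Γ ξ := fun ξ hξ =>
    (mem_filter.mp (hEL hξ)).2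
  rw [repLevelCosets, ← himg, card_image_of_injOn hE]
  exact h p Γ hΓ hpos hp E (fun h0 => (hmem 0 h0).1 rfl) hE v fun ξ hξ => (hmem ξ hξ).2

theorem one_le_pow_mul_div {s ψ : ℝ} (hs : 1 ≤ s) (hψ : 1 ≤ ψ) {a : ℕ}
    (h : a = 0 → ψ = s) : 1 ≤ s ^ a * ψ / s := by
  have hs0 : 0 < s := by linarith
  rw [one_le_div hs0]
  rcases a with _ | a
  · simp [h rfl]
  · rw [pow_succ, mul_right_comm]
    exact le_mul_of_one_le_left hs0.le (one_le_mul_of_one_le_of_one_le (one_le_pow₀ hs) hψ)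

theorem le_of_layer_cake {t j R a : ℕ} {f N : ℕ → ℕ} {c w : ℝ} (ht : 0 < t) (hj : 0 < j)
    (hjt : j ≤ t) (hc : 1 ≤ c) (hw : 1 ≤ w) (hw0 : a = 0 → w = t)
    (hlevel : ∀ v : ℕ, (v : ℝ) ^ 3 * f v * (t : ℝ) ^ 2 ≤ c ^ 3 * (t : ℝ) ^ (3 * a) * w ^ 2)
    (hsum : ∑ v ∈ Icc 1 (t ^ a), f v ≤ t ^ a)
    (hstep : ∀ v, N v ^ 3 ≤ 2 ^ 14 * (j * f v * t) ^ 2 ∨ N v ≤ 82 * (j * f v))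
    (hcake : j * R ≤ t ^ a + ∑ v ∈ Icc 1 (t ^ a), N v) :
    (R : ℝ) ^ 3 * j * (t : ℝ) ^ 2 ≤
      (83 + 82 * (1 + 4 * c ^ 2)) ^ 3 * (t : ℝ) ^ (3 * (a + 1)) * w := by
  obtain ⟨s, hs0, hs⟩ := exists_cube_root (Nat.cast_nonneg (α := ℝ) t)
  obtain ⟨J, hJ0, hJ⟩ := exists_cube_root (Nat.cast_nonneg (α := ℝ) j)
  obtain ⟨ψ, hψ0, rfl⟩ := exists_cube_root (zero_le_one.trans hw)
  have hroot : ∀ v, ∃ y : ℝ, 0 ≤ y ∧ y ^ 3 = (f v : ℝ) := fun v =>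
    exists_cube_root (Nat.cast_nonneg _)
  choose φ hφ0 hφ using hroot
  have hs1 : 1 ≤ s := by
    rw [← one_le_pow_iff_of_nonneg hs0 (three_ne_zero), hs]
    exact_mod_cast ht
  have hJ1 : 1 ≤ J := by
    rw [← one_le_pow_iff_of_nonneg hJ0 (three_ne_zero), hJ]
    exact_mod_cast hj
  have hψ1 : 1 ≤ ψ := (one_le_pow_iff_of_nonneg hψ0 (three_ne_zero)).mp hw
  have hJs : J ≤ s := by
    rw [← pow_le_pow_iff_left₀ hJ0 hs0 three_ne_zero, hs, hJ]
    exact_mod_cast hjt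
  have hsne : s ≠ 0 := by linarith
  set τ : ℝ := s ^ a with hτ
  have hτ0 : 0 < τ := by positivity
  have hτ3 : τ ^ 3 = (t : ℝ) ^ a := by rw [hτ, ← hs]; ring
  have hω : 1 ≤ τ * ψ / s := one_le_pow_mul_div hs1 hψ1 fun ha => by
    rw [← pow_left_inj₀ hψ0 hs0 three_ne_zero, hs, hw0 ha]
  have hsum' : ∑ v ∈ Icc 1 (t ^ a), φ v ^ 3 ≤ τ ^ 3 := by
    simp only [hφ, hτ3]
    exact_mod_cast hsum
  have hsq := sum_sq_le_of_weak_bound hφ0 hτ0 hω hc hsum' fun v _ => by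
    have h1 := hlevel v
    rw [← hφ v, ← hs] at h1
    have h2 : c ^ 3 * (s ^ 3) ^ (3 * a) * (ψ ^ 3) ^ 2 =
        c ^ 3 * τ ^ 3 * (τ * ψ / s) ^ 6 * (s ^ 3) ^ 2 := by
      have : (s ^ 3) ^ (3 * a) = τ ^ 9 := by rw [hτ]; ring
      rw [this]
      field_simp
    rw [h2] at h1
    exact le_of_mul_le_mul_right h1 (by positivity)
  have hN : ∀ v, (N v : ℝ) ≤ 82 * (J ^ 2 * s ^ 2 * φ v ^ 2) + 82 * J ^ 3 * φ v ^ 3 := by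
    intro v
    have hφv := hφ0 v
    rcases hstep v with h | h
    · have h1 : (N v : ℝ) ^ 3 ≤ 2 ^ 14 * (j * f v * t) ^ 2 := by exact_mod_cast h
      rw [← hs, ← hJ, ← hφ v] at h1
      have h2 : (N v : ℝ) ≤ 82 * (J ^ 2 * s ^ 2 * φ v ^ 2) := by
        refine le_of_pow_le_pow_left₀ three_ne_zero (by positivity) (h1.trans ?_)
        have h3 : (82 * (J ^ 2 * s ^ 2 * φ v ^ 2)) ^ 3 =
          82 ^ 3 * (J ^ 3 * φ v ^ 3 * s ^ 3) ^ 2 := by ring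
        rw [h3]
        gcongr
        norm_num
      have : 0 ≤ 82 * J ^ 3 * φ v ^ 3 := by positivity
      linarith
    · have h1 : (N v : ℝ) ≤ 82 * (j * f v) := by exact_mod_cast h
      rw [← hJ, ← hφ v] at h1
      have : 0 ≤ 82 * (J ^ 2 * s ^ 2 * φ v ^ 2) := by positivity
      linarith
  have hmain : J ^ 3 * R ≤ J ^ 2 * ((83 + 82 * (1 + 4 * c ^ 2)) * (s * τ ^ 3 * ψ)) := by
    have h1 : (j : ℝ) * R ≤ (t : ℝ) ^ a + ∑ v ∈ Icc 1 (t ^ a), (N v : ℝ) := by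
      exact_mod_cast hcake
    rw [← hJ, ← hτ3] at h1
    have h2 : ∑ v ∈ Icc 1 (t ^ a), (N v : ℝ) ≤
        82 * (J ^ 2 * s ^ 2 * ((1 + 4 * c ^ 2) * τ ^ 2 * (τ * ψ / s))) + 82 * J ^ 3 * τ ^ 3 := by
      refine (sum_le_sum fun v _ => hN v).trans ?_
      rw [sum_add_distrib, ← mul_sum, ← mul_sum, ← mul_sum]
      gcongr
    have h3 : J ^ 2 * s ^ 2 * ((1 + 4 * c ^ 2) * τ ^ 2 * (τ * ψ / s)) =
        (1 + 4 * c ^ 2) * (J ^ 2 * (s * τ ^ 3 * ψ)) := by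
      field_simp
    have h4 : τ ^ 3 ≤ J ^ 2 * (s * τ ^ 3 * ψ) := by
      have : 1 ≤ J ^ 2 * (s * ψ) := one_le_mul_of_one_le_of_one_le (one_le_pow₀ hJ1)
        (one_le_mul_of_one_le_of_one_le hs1 hψ1)
      calc τ ^ 3 ≤ J ^ 2 * (s * ψ) * τ ^ 3 := le_mul_of_one_le_left (by positivity) this
        _ = J ^ 2 * (s * τ ^ 3 * ψ) := by ring
    have h5 : J ^ 3 * τ ^ 3 ≤ J ^ 2 * (s * τ ^ 3 * ψ) := by
      have : J ≤ s * ψ := hJs.trans (le_mul_of_one_le_right hs0 hψ1)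
      calc J ^ 3 * τ ^ 3 = J ^ 2 * τ ^ 3 * J := by ring
        _ ≤ J ^ 2 * τ ^ 3 * (s * ψ) := by gcongr
        _ = J ^ 2 * (s * τ ^ 3 * ψ) := by ring
    rw [h3] at h2
    linarith
  have hJR : J * R ≤ (83 + 82 * (1 + 4 * c ^ 2)) * (s * τ ^ 3 * ψ) := by
    refine le_of_mul_le_mul_left ?_ (pow_pos (zero_lt_one.trans_le hJ1) 2)
    linarith
  calc (R : ℝ) ^ 3 * j * (t : ℝ) ^ 2 = (J * R) ^ 3 * (t : ℝ) ^ 2 := by rw [← hJ]; ring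
    _ ≤ ((83 + 82 * (1 + 4 * c ^ 2)) * (s * τ ^ 3 * ψ)) ^ 3 * (t : ℝ) ^ 2 := by gcongr
    _ = (83 + 82 * (1 + 4 * c ^ 2)) ^ 3 * (s ^ 3 * (τ ^ 3) ^ 3 * ψ ^ 3) * (t : ℝ) ^ 2 := by ring
    _ = (83 + 82 * (1 + 4 * c ^ 2)) ^ 3 * (t : ℝ) ^ (3 * (a + 1)) * ψ ^ 3 := by
      rw [hs, hτ3]
      ring

theorem WeakRepBound.succ {a : ℕ} {c : ℝ} (hc : 1 ≤ c) (h : WeakRepBound a c) :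
    WeakRepBound (a + 1) (83 + 82 * (1 + 4 * c ^ 2)) := by
  intro p _ Γ hΓ hpos hp E hE0 hE R hR
  set c' : ℝ := 83 + 82 * (1 + 4 * c ^ 2) with hc'
  have hc'1 : 1 ≤ c' := by nlinarith
  have ht1 : (1 : ℝ) ≤ #Γ := by exact_mod_cast hpos
  have hw1 : 1 ≤ (#Γ : ℝ) ^ ((1 / 2 : ℝ) ^ a) := Real.one_le_rpow ht1 (by positivity)
  have hww : ((#Γ : ℝ) ^ ((1 / 2 : ℝ) ^ (a + 1))) ^ 2 = (#Γ : ℝ) ^ ((1 / 2 : ℝ) ^ a) := by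
    rw [← Real.rpow_natCast, ← Real.rpow_mul (by positivity)]
    congr 1
    rw [pow_succ]
    push_cast
    ring
  rw [hww]
  by_cases hjt : #Γ < #E
  · have h1 := mul_card_mul_card_le (a + 2) hΓ hpos hE0 hE hR
    have h2 : R * #E ≤ #Γ ^ (a + 1) := by
      refine Nat.le_of_mul_le_mul_left (Eq.trans_le ?_ (h1.trans_eq (pow_succ' _ _))) hpos
      ring
    have h3 : R ^ 3 * #E * #Γ ^ 2 ≤ #Γ ^ (3 * (a + 1)) := by
      calc R ^ 3 * #E * #Γ ^ 2 ≤ R ^ 3 * #E * #E ^ 2 := by gcongr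
        _ = (R * #E) ^ 3 := by ring
        _ ≤ (#Γ ^ (a + 1)) ^ 3 := Nat.pow_le_pow_left h2 3
        _ = #Γ ^ (3 * (a + 1)) := by rw [← pow_mul, mul_comm]
    have h4 : (R : ℝ) ^ 3 * #E * (#Γ : ℝ) ^ 2 ≤ (#Γ : ℝ) ^ (3 * (a + 1)) := by exact_mod_cast h3
    refine h4.trans ?_
    rw [mul_right_comm]
    exact le_mul_of_one_le_left (by positivity)
      (one_le_mul_of_one_le_of_one_le (one_le_pow₀ hc'1) hw1)
  rw [not_lt] at hjt
  rcases Nat.eq_zero_or_pos #E with hj0 | hj0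
  · rw [hj0]
    simp only [Nat.cast_zero, mul_zero, zero_mul]
    positivity
  have hcake := sum_repCount_succ_le a hΓ hE
  have hRsum : #E * R ≤ ∑ ξ ∈ E, repCount (a + 2) Γ ξ := by
    rw [← smul_eq_mul]
    exact card_nsmul_le_sum _ _ _ hR
  exact le_of_layer_cake hpos hj0 hjt hc hw1 (by rintro rfl; simp)
    (h.repLevelCosets_le hΓ hpos hp) (sum_repLevelCosets_le a hΓ hpos (#Γ ^ a))
    (sum_card_sub_mem_repLevel_le (a + 1) hΓ hpos hp hE0 hE) (hRsum.trans hcake)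

theorem exists_weakRepBound (a : ℕ) : ∃ c : ℝ, 1 ≤ c ∧ WeakRepBound a c := by
  induction a with
  | zero => exact ⟨1, le_rfl, weakRepBound_zero⟩
  | succ a ih =>
    obtain ⟨c, hc, h⟩ := ih
    exact ⟨_, by nlinarith, h.succ hc⟩

/-- For every integer `d ≥ 2` there is a constant `C_d > 0` with the following
property. Let `p` be prime and `Γ ⊆ F_p^*` a multiplicative subgroup with `|Γ| < p^{1/2}`.
Then for every `j ≥ 1` and every collection `ξ₁, …, ξ_j` of `j` nonzero elements of `F_p`
lying in pairwise distinct cosets of `Γ`, one has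
`min_i r_d(ξ_i) ≤ C_d · |Γ|^{d − 2 + (1 + 2^{2−d})/3} · j^{−1/3}`. -/
theorem stmt8 :
    ∀ d : ℕ, 2 ≤ d →
      ∃ C : ℝ, 0 < C ∧
        ∀ (p : ℕ) [Fact p.Prime], ∀ Γ : Finset (ZMod p),
          (0 : ZMod p) ∉ Γ → (1 : ZMod p) ∈ Γ →
          (∀ x ∈ Γ, ∀ y ∈ Γ, x * y ∈ Γ) → (∀ x ∈ Γ, x⁻¹ ∈ Γ) →
          (Γ.card : ℝ) < (p : ℝ) ^ ((1 : ℝ) / 2) →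
          ∀ j : ℕ, 1 ≤ j → ∀ ξ : Fin j → ZMod p,
            (∀ i, ξ i ≠ 0) →
            (∀ i i', i ≠ i' → ξ i / ξ i' ∉ Γ) →
            ∃ i, (repCount d Γ (ξ i) : ℝ) ≤
              C * (Γ.card : ℝ) ^ ((d : ℝ) - 2 + (1 + (2 : ℝ) ^ (2 - (d : ℝ))) / 3) *
                (j : ℝ) ^ (-(1 : ℝ) / 3) := by
  intro d hd
  obtain ⟨a, rfl⟩ : ∃ a, d = a + 1 := ⟨d - 1, by omega⟩
  obtain ⟨c, hc, hbound⟩ := exists_weakRepBound a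
  refine ⟨c, by linarith, ?_⟩
  intro p _ Γ h0 h1 hmul _ hcard j hj ξ hξ0 hξ
  have hΓ := mem_iff_pow_card_eq_one h0 h1 hmul
  have hpos : 0 < #Γ := card_pos.mpr ⟨1, h1⟩
  have hp : #Γ * #Γ < p := by
    have h2 := pow_lt_pow_left₀ hcard (Nat.cast_nonneg _) two_ne_zero
    rw [← Real.rpow_natCast ((p : ℝ) ^ _), ← Real.rpow_mul (Nat.cast_nonneg p)] at h2
    norm_num at h2
    rw [← sq]
    exact_mod_cast h2
  have hinj : Function.Injective fun i => ξ i ^ #Γ := by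
    intro i i' h
    by_contra hne
    refine hξ i i' hne ((hΓ _).mpr ?_)
    rw [div_pow, div_eq_one_iff_eq (pow_ne_zero _ (hξ0 i'))]
    exact h
  have hinj' : Function.Injective ξ := fun i i' h => hinj (congrArg (· ^ #Γ) h)
  obtain ⟨i, -, hi⟩ := exists_min_image univ (fun i => repCount (a + 1) Γ (ξ i))
    ⟨⟨0, hj⟩, mem_univ _⟩
  refine ⟨i, ?_⟩
  have hR := hbound p Γ hΓ hpos hp (univ.image ξ)
    (by simpa using hξ0)
    (by
      intro x hx y hy h
      simp only [coe_image, coe_univ, Set.image_univ, Set.mem_range] at hx hy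
      obtain ⟨k, rfl⟩ := hx
      obtain ⟨l, rfl⟩ := hy
      exact congrArg ξ (hinj h))
    (repCount (a + 1) Γ (ξ i)) (by simpa using hi)
  rw [card_image_of_injective _ hinj', card_univ, Fintype.card_fin] at hR
  generalize repCount (a + 1) Γ (ξ i) = R at hR ⊢
  have ht : (0 : ℝ) < #Γ := by exact_mod_cast hpos
  have hj0 : (0 : ℝ) < j := by exact_mod_cast hj
  generalize (#Γ : ℝ) = t at hR ht ⊢
  have hexp : (2 : ℝ) ^ (2 - ((a + 1 : ℕ) : ℝ)) = 2 * (1 / 2 : ℝ) ^ a := by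
    rw [show (2 : ℝ) - ((a + 1 : ℕ) : ℝ) = 1 - a by push_cast; ring, Real.rpow_sub two_pos,
      Real.rpow_one, Real.rpow_natCast]
    field_simp
    simp
  rw [hexp]
  refine le_of_pow_le_pow_left₀ three_ne_zero (by positivity) ?_
  have hcube : (c * t ^ (((a + 1 : ℕ) : ℝ) - 2 + (1 + 2 * (1 / 2 : ℝ) ^ a) / 3) *
      (j : ℝ) ^ (-(1 : ℝ) / 3)) ^ 3 * (j * t ^ 2) =
        c ^ 3 * t ^ (3 * a) * (t ^ ((1 / 2 : ℝ) ^ a)) ^ 2 := by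
    have e1 : ((j : ℝ) ^ (-(1 : ℝ) / 3)) ^ 3 * j = 1 := by
      rw [← Real.rpow_natCast, ← Real.rpow_mul hj0.le]
      norm_num
      rw [Real.rpow_neg_one, inv_mul_cancel₀ hj0.ne']
    have e2 : (t ^ (((a + 1 : ℕ) : ℝ) - 2 + (1 + 2 * (1 / 2 : ℝ) ^ a) / 3)) ^ 3 * t ^ 2 =
        t ^ (3 * a) * (t ^ ((1 / 2 : ℝ) ^ a)) ^ 2 := by
      simp only [← Real.rpow_natCast, ← Real.rpow_mul ht.le, ← Real.rpow_add ht]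
      congr 1
      push_cast
      ring
    calc _ = c ^ 3 * ((t ^ (((a + 1 : ℕ) : ℝ) - 2 + (1 + 2 * (1 / 2 : ℝ) ^ a) / 3)) ^ 3 * t ^ 2) *
          (((j : ℝ) ^ (-(1 : ℝ) / 3)) ^ 3 * j) := by ring
      _ = _ := by rw [e1, e2]; ring
  refine le_of_mul_le_mul_right (hcube ▸ ?_) (show 0 < (j : ℝ) * t ^ 2 by positivity)
  rw [← mul_assoc]
  exact hR
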